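/- arXiv:2404.11880 — 2 statements merged into one kernel-verified Lean document; each statement's English description precedes it below -/
import Mathlib

section
/- Assume S_U ⊆ (0, ∞) and S_L ⊆ (0, ∞), and let q ∈ ℝ and α ∈ ℝ. Then Σ_{j=1}^k w_j Φ(f(A_j)) ≤ α·B_U^q + ( max_{x ∈ S_U} (x − α·x^q) )·1_K, and Σ_{j=1}^k w_j Φ(f(A_j)) ≥ α·B_L^q + ( min_{x ∈ S_L} (x − α·x^q) )·1_K, in the Loewner order, where powers of B_U and B_L are taken via continuous functional calculus and 1_K is the identity operator on K. -/
open ContinuousLinearMap in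
/-- The Kantorovich constant `K(m', M', r)`, with the convention that it equals `1`
for `r = 0` and `r = 1`. -/
noncomputable def kantorovich (m M r : ℝ) : ℝ :=
  if r = 0 ∨ r = 1 then 1 else
    ((m * M ^ r - M * m ^ r) / ((r - 1) * (M - m))) *
      (((r - 1) * (M ^ r - m ^ r)) / (r * (m * M ^ r - M * m ^ r))) ^ r

open ContinuousLinearMap Polynomial

theorem kantorovich_natCast_add_two_ge_one {m M : ℝ} (hm : 0 < m) (hmM : m < M) (p : ℕ) :
    1 ≤ kantorovich m M ((p + 2 : ℕ) : ℝ) := by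
  have hM : 0 < M := hm.trans hmM
  have hn0 : ((p + 2 : ℕ) : ℝ) ≠ 0 := by positivity
  have hn1 : ((p + 2 : ℕ) : ℝ) ≠ 1 := by
    push_cast; linarith [(Nat.cast_nonneg p : (0 : ℝ) ≤ p)]
  rw [kantorovich, if_neg (by tauto)]
  simp only [Real.rpow_natCast]
  have hpow : m ^ (p + 1) < M ^ (p + 1) := pow_lt_pow_left₀ hmM hm.le (by omega)
  have hE : 0 < M ^ (p + 2) - m ^ (p + 2) :=
    sub_pos.2 (pow_lt_pow_left₀ hmM hm.le (by omega))
  have hD : 0 < m * M ^ (p + 2) - M * m ^ (p + 2) := by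
    have : m * M ^ (p + 2) - M * m ^ (p + 2) = m * M * (M ^ (p + 1) - m ^ (p + 1)) := by ring
    rw [this]
    exact mul_pos (mul_pos hm hM) (sub_pos.2 hpow)
  have hDelta : 0 < M - m := sub_pos.2 hmM
  have hr : ((p + 2 : ℕ) : ℝ) - 1 = p + 1 := by push_cast; ring
  rw [hr]
  have hid : m * (M ^ (p + 2) - m ^ (p + 2)) - (m * M ^ (p + 2) - M * m ^ (p + 2))
      = m ^ (p + 2) * (M - m) := by ring
  generalize M ^ (p + 2) - m ^ (p + 2) = E at *
  generalize m * M ^ (p + 2) - M * m ^ (p + 2) = D at *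
  have hmp : 0 < m ^ (p + 2) := by positivity
  set y := (((p : ℝ) + 1) * E) / (((p + 2 : ℕ) : ℝ) * D) with hy
  have hy0 : 0 < y := by positivity
  have hbern := one_add_mul_le_pow (a := m * y - 1) (by nlinarith [mul_pos hm hy0]) (p + 2)
  have hc : 0 < D / (((p : ℝ) + 1) * (M - m)) := by positivity
  have hkey : D / (((p : ℝ) + 1) * (M - m)) * (1 + ((p + 2 : ℕ) : ℝ) * (m * y - 1))
      = m ^ (p + 2) := by
    have h1 : D / (((p : ℝ) + 1) * (M - m)) * (1 + ((p + 2 : ℕ) : ℝ) * (m * y - 1))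
      = (m * E - D) / (M - m) := by
      rw [hy]
      push_cast
      field_simp
      ring
    rw [h1, hid]
    field_simp
  have h2 := mul_le_mul_of_nonneg_left hbern hc.le
  rw [hkey, add_sub_cancel, mul_pow] at h2
  refine le_of_mul_le_mul_left ?_ hmp
  linarith

theorem one_le_kantorovich_natCast {m M : ℝ} (hm : 0 < m) (hmM : m < M) (n : ℕ) :
    1 ≤ kantorovich m M (n : ℝ) := by
  match n with
  | 0 => simp [kantorovich]
  | 1 => simp [kantorovich]
  | p + 2 => exact kantorovich_natCast_add_two_ge_one hm hmM p

section Scalar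

variable {a : ℕ → ℝ} {l y u : ℝ} {κ μ : ℕ → ℝ}

theorem sum_mul_pow_le_of_bounds (hl : 0 < l) (hly : l ≤ y) (hyu : y ≤ u)
    (hκ : ∀ i, 1 ≤ κ i) (hμ : ∀ i, 1 ≤ μ i) (s : Finset ℕ) :
    ∑ i ∈ s, a i * y ^ i ≤
      ∑ i ∈ s.filter (fun i => 0 ≤ a i), a i * κ i * u ^ i +
        ∑ i ∈ s.filter (fun i => a i < 0), a i * (μ i)⁻¹ * l ^ i := by
  have hy : 0 < y := hl.trans_le hly
  rw [← Finset.sum_filter_add_sum_filter_not s (fun i => 0 ≤ a i)]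
  simp only [not_le]
  refine add_le_add (Finset.sum_le_sum fun i hi => ?_) (Finset.sum_le_sum fun i hi => ?_)
  · rw [mul_assoc]
    refine mul_le_mul_of_nonneg_left ?_ (Finset.mem_filter.1 hi).2
    calc y ^ i ≤ u ^ i := pow_le_pow_left₀ hy.le hyu i
      _ ≤ κ i * u ^ i := le_mul_of_one_le_left (pow_nonneg (hy.le.trans hyu) i) (hκ i)
  · rw [mul_assoc]
    refine mul_le_mul_of_nonpos_left ?_ (Finset.mem_filter.1 hi).2.le
    calc (μ i)⁻¹ * l ^ i ≤ l ^ i :=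
          mul_le_of_le_one_left (pow_nonneg hl.le i) (inv_le_one_of_one_le₀ (hμ i))
      _ ≤ y ^ i := pow_le_pow_left₀ hl.le hly i

theorem le_sum_mul_pow_of_bounds (hl : 0 < l) (hly : l ≤ y) (hyu : y ≤ u)
    (hκ : ∀ i, 1 ≤ κ i) (hμ : ∀ i, 1 ≤ μ i) (s : Finset ℕ) :
    ∑ i ∈ s.filter (fun i => 0 ≤ a i), a i * (μ i)⁻¹ * l ^ i +
        ∑ i ∈ s.filter (fun i => a i < 0), a i * κ i * u ^ i ≤
      ∑ i ∈ s, a i * y ^ i := by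
  have hy : 0 < y := hl.trans_le hly
  rw [← Finset.sum_filter_add_sum_filter_not s (fun i => 0 ≤ a i) (fun i => a i * y ^ i)]
  simp only [not_le]
  refine add_le_add (Finset.sum_le_sum fun i hi => ?_) (Finset.sum_le_sum fun i hi => ?_)
  · rw [mul_assoc]
    refine mul_le_mul_of_nonneg_left ?_ (Finset.mem_filter.1 hi).2
    calc (μ i)⁻¹ * l ^ i ≤ l ^ i :=
          mul_le_of_le_one_left (pow_nonneg hl.le i) (inv_le_one_of_one_le₀ (hμ i))
      _ ≤ y ^ i := pow_le_pow_left₀ hl.le hly i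
  · rw [mul_assoc]
    refine mul_le_mul_of_nonpos_left ?_ (Finset.mem_filter.1 hi).2.le
    calc y ^ i ≤ u ^ i := pow_le_pow_left₀ hy.le hyu i
      _ ≤ κ i * u ^ i := le_mul_of_one_le_left (pow_nonneg (hy.le.trans hyu) i) (hκ i)

end Scalar

theorem Polynomial.sInf_image_eval_Icc_pos {p : Polynomial ℝ} {m M : ℝ} (hmM : m ≤ M)
    (hp : ∀ x ∈ Set.Icc m M, 0 < p.eval x) :
    0 < sInf ((fun x => p.eval x) '' Set.Icc m M) := by
  have hne : ((fun x => p.eval x) '' Set.Icc m M).Nonempty := (Set.nonempty_Icc.2 hmM).image _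
  obtain ⟨x, hx, hx'⟩ := (isCompact_Icc.image p.continuous).sInf_mem hne
  rw [← hx']
  exact hp x hx

theorem isCompact_closure_convexHull_iUnion_image_Icc {ι : Type*} [Finite ι] {m M : ι → ℝ}
    {g : ι → ℝ → ℝ} (hg : ∀ j, Continuous (g j)) :
    IsCompact (closure (convexHull ℝ (⋃ j, g j '' Set.Icc (m j) (M j)))) := by
  refine Metric.isCompact_of_isClosed_isBounded isClosed_closure ?_
  refine Bornology.IsBounded.closure (isBounded_convexHull.2 ?_)
  exact (isCompact_iUnion fun j => isCompact_Icc.image (hg j)).isBounded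

theorem Real.continuousOn_id_sub_mul_rpow {S : Set ℝ} (hS : S ⊆ Set.Ioi 0) (q α : ℝ) :
    ContinuousOn (fun x : ℝ => x - α * x ^ q) S :=
  continuousOn_id.sub (continuousOn_const.mul
    (continuousOn_id.rpow_const fun _ hx => Or.inl (ne_of_gt (hS hx))))

section Compression

variable {H K : Type*} [NormedAddCommGroup H] [InnerProductSpace ℂ H] [CompleteSpace H]
  [NormedAddCommGroup K] [InnerProductSpace ℂ K] [CompleteSpace K]
  {ι : Type*} [Fintype ι] {w : ι → ℝ} {V : K →L[ℂ] H}

theorem sum_smul_adjoint_conj_mono (hw : ∀ j, 0 ≤ w j) {X Y : ι → H →L[ℂ] H}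
    (h : ∀ j, X j ≤ Y j) :
    ∑ j, w j • ((adjoint V) ∘L (X j) ∘L V) ≤ ∑ j, w j • ((adjoint V) ∘L (Y j) ∘L V) := by
  refine Finset.sum_le_sum fun j _ => smul_le_smul_of_nonneg_left ?_ (hw j)
  have := (ContinuousLinearMap.le_def _ _).1 (h j)
  rw [ContinuousLinearMap.le_def]
  simpa [ContinuousLinearMap.sub_comp, ContinuousLinearMap.comp_sub] using this.adjoint_conj V

theorem sum_smul_adjoint_conj_algebraMap (hV : (adjoint V) ∘L V = 1) (hw1 : ∑ j, w j = 1)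
    (c : ℝ) :
    ∑ j, w j • ((adjoint V) ∘L (algebraMap ℝ (H →L[ℂ] H) c) ∘L V) =
      algebraMap ℝ (K →L[ℂ] K) c := by
  have : (adjoint V) ∘L (algebraMap ℝ (H →L[ℂ] H) c) ∘L V = algebraMap ℝ (K →L[ℂ] K) c := by
    rw [Algebra.algebraMap_eq_smul_one, Algebra.algebraMap_eq_smul_one, ← hV]
    ext x
    simp
  rw [this, ← Finset.sum_smul, hw1, one_smul]

theorem isSelfAdjoint_sum_smul_adjoint_conj {X : ι → H →L[ℂ] H} (hX : ∀ j, IsSelfAdjoint (X j)) :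
    IsSelfAdjoint (∑ j, w j • ((adjoint V) ∘L (X j) ∘L V)) :=
  isSelfAdjoint_sum _ fun j _ => (IsSelfAdjoint.all (w j)).smul ((hX j).adjoint_conj V)

theorem spectrum_sum_smul_adjoint_conj_cfc_subset (hV : (adjoint V) ∘L V = 1)
    (hw : ∀ j, 0 ≤ w j) (hw1 : ∑ j, w j = 1) {A : ι → H →L[ℂ] H}
    (hA : ∀ j, IsSelfAdjoint (A j)) {g : ι → ℝ → ℝ} (hg : ∀ j, Continuous (g j)) {S : Set ℝ}
    (hS : IsCompact S) (hSne : S.Nonempty) (hSc : S.OrdConnected)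
    (hgS : ∀ j, ∀ x ∈ spectrum ℝ (A j), g j x ∈ S) :
    spectrum ℝ (∑ j, w j • ((adjoint V) ∘L (cfc (g j) (A j)) ∘L V)) ⊆ S := by
  have hsa : IsSelfAdjoint (∑ j, w j • ((adjoint V) ∘L (cfc (g j) (A j)) ∘L V)) :=
    isSelfAdjoint_sum_smul_adjoint_conj fun j => cfc_predicate _ _
  intro x hx
  refine hSc.out (hS.sInf_mem hSne) (hS.sSup_mem hSne) ⟨?_, ?_⟩
  · refine (algebraMap_le_iff_le_spectrum hsa).1 ?_ x hx
    rw [← sum_smul_adjoint_conj_algebraMap hV hw1]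
    exact sum_smul_adjoint_conj_mono hw fun j => algebraMap_le_cfc _ _ _
      (fun y hy => csInf_le hS.bddBelow (hgS j y hy)) (hg j).continuousOn (hA j)
  · refine (le_algebraMap_iff_spectrum_le hsa).1 ?_ x hx
    rw [← sum_smul_adjoint_conj_algebraMap hV hw1]
    exact sum_smul_adjoint_conj_mono hw fun j => cfc_le_algebraMap _ _ _
      (fun y hy => le_csSup hS.bddAbove (hgS j y hy)) (hg j).continuousOn (hA j)

theorem sum_smul_pow_cfc {A : H →L[ℂ] H} (hA : IsSelfAdjoint A) {f : ℝ → ℝ}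
    (hf : ContinuousOn f (spectrum ℝ A)) (a : ℕ → ℝ) (s : Finset ℕ) :
    ∑ i ∈ s, a i • (cfc f A) ^ i = cfc (fun x => ∑ i ∈ s, a i * f x ^ i) A := by
  have hsum := cfc_sum (fun i x => a i * f x ^ i) A s
    (fun i _ => continuousOn_const.mul (hf.pow i))
  rw [show (fun x => ∑ i ∈ s, a i * f x ^ i) = ∑ i ∈ s, fun x => a i * f x ^ i by
    ext x; simp, hsum]
  refine Finset.sum_congr rfl fun i _ => ?_
  rw [cfc_const_mul (a i) (fun x => f x ^ i) A (hf.pow i), cfc_pow f i A hf hA]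

theorem smul_cfc_rpow_add_smul_one {B : K →L[ℂ] K} (hB : IsSelfAdjoint B)
    (hpos : spectrum ℝ B ⊆ Set.Ioi 0) (q α c : ℝ) :
    α • cfc (fun x : ℝ => x ^ q) B + c • (1 : K →L[ℂ] K) =
      cfc (fun x : ℝ => α * x ^ q + c) B := by
  have hc : ContinuousOn (fun x : ℝ => x ^ q) (spectrum ℝ B) :=
    continuousOn_id.rpow_const fun x hx => Or.inl (ne_of_gt (hpos hx))
  rw [cfc_add B (fun x => α * x ^ q) (fun _ => c) (continuousOn_const.mul hc) continuousOn_const,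
    cfc_const_mul α _ B hc, cfc_const c B hB, Algebra.algebraMap_eq_smul_one]

theorem le_smul_cfc_rpow_add_sSup {B : K →L[ℂ] K} (hB : IsSelfAdjoint B) {S : Set ℝ}
    (hS : IsCompact S) (hBS : spectrum ℝ B ⊆ S) (hpos : S ⊆ Set.Ioi 0) (q α : ℝ) :
    B ≤ α • cfc (fun x : ℝ => x ^ q) B +
      (sSup ((fun x => x - α * x ^ q) '' S)) • (1 : K →L[ℂ] K) := by
  have hbdd := (hS.image_of_continuousOn (Real.continuousOn_id_sub_mul_rpow hpos q α)).bddAbove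
  rw [smul_cfc_rpow_add_smul_one hB (hBS.trans hpos)]
  conv_lhs => rw [← cfc_id ℝ B hB]
  refine cfc_mono (fun x hx => ?_) continuousOn_id ?_
  · have := le_csSup hbdd (Set.mem_image_of_mem _ (hBS hx))
    simp only [id]
    linarith
  · exact (continuousOn_const.mul (continuousOn_id.rpow_const
      fun x hx => Or.inl (ne_of_gt (hpos (hBS hx))))).add continuousOn_const

theorem smul_cfc_rpow_add_sInf_le {B : K →L[ℂ] K} (hB : IsSelfAdjoint B) {S : Set ℝ}
    (hS : IsCompact S) (hBS : spectrum ℝ B ⊆ S) (hpos : S ⊆ Set.Ioi 0) (q α : ℝ) :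
    α • cfc (fun x : ℝ => x ^ q) B +
      (sInf ((fun x => x - α * x ^ q) '' S)) • (1 : K →L[ℂ] K) ≤ B := by
  have hbdd := (hS.image_of_continuousOn (Real.continuousOn_id_sub_mul_rpow hpos q α)).bddBelow
  rw [smul_cfc_rpow_add_smul_one hB (hBS.trans hpos)]
  conv_rhs => rw [← cfc_id ℝ B hB]
  refine cfc_mono (fun x hx => ?_) ?_ continuousOn_id
  · have := csInf_le hbdd (Set.mem_image_of_mem _ (hBS hx))
    simp only [id]
    linarith
  · exact (continuousOn_const.mul (continuousOn_id.rpow_const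
      fun x hx => Or.inl (ne_of_gt (hpos (hBS hx))))).add continuousOn_const

end Compression

theorem stmt4
    {H K : Type*} [NormedAddCommGroup H] [InnerProductSpace ℂ H] [CompleteSpace H]
    [NormedAddCommGroup K] [InnerProductSpace ℂ K] [CompleteSpace K]
    (V : K →L[ℂ] H) (hV : (adjoint V) ∘L V = 1)
    (I : ℕ) (a : ℕ → ℝ)
    (k : ℕ) (hk : 1 ≤ k)
    (w : Fin k → ℝ) (hw : ∀ j, 0 ≤ w j) (hw1 : ∑ j, w j = 1)
    (m M : Fin k → ℝ) (hmM : ∀ j, m j < M j)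
    (A : Fin k → H →L[ℂ] H) (hA : ∀ j, IsSelfAdjoint (A j))
    (hspec : ∀ j, spectrum ℝ (A j) ⊆ Set.Icc (m j) (M j))
    (f : ℝ → ℝ) (hf : ContinuousOn f (⋃ j, Set.Icc (m j) (M j)))
    (pL pU : Polynomial ℝ)
    (hp : ∀ x ∈ ⋃ j, Set.Icc (m j) (M j),
      0 < pL.eval x ∧ pL.eval x ≤ f x ∧ f x ≤ pU.eval x)
    (mU MU mL ML : Fin k → ℝ)
    (hmU : ∀ j, mU j = sInf ((fun x => pU.eval x) '' Set.Icc (m j) (M j)))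
    (hMU : ∀ j, MU j = sSup ((fun x => pU.eval x) '' Set.Icc (m j) (M j)))
    (hmL : ∀ j, mL j = sInf ((fun x => pL.eval x) '' Set.Icc (m j) (M j)))
    (hML : ∀ j, ML j = sSup ((fun x => pL.eval x) '' Set.Icc (m j) (M j)))
    (hUlt : ∀ j, mU j < MU j) (hLlt : ∀ j, mL j < ML j)
    (qU qL : Fin k → ℝ → ℝ)
    (hqU : ∀ j x, qU j x =
      (∑ i ∈ (Finset.range (I + 1)).filter (fun i => 0 ≤ a i),
        a i * kantorovich (mU j) (MU j) (i : ℝ) * (pU.eval x) ^ i) +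
      ∑ i ∈ (Finset.range (I + 1)).filter (fun i => a i < 0),
        a i * (kantorovich (mL j) (ML j) (i : ℝ))⁻¹ * (pL.eval x) ^ i)
    (hqL : ∀ j x, qL j x =
      (∑ i ∈ (Finset.range (I + 1)).filter (fun i => 0 ≤ a i),
        a i * (kantorovich (mL j) (ML j) (i : ℝ))⁻¹ * (pL.eval x) ^ i) +
      ∑ i ∈ (Finset.range (I + 1)).filter (fun i => a i < 0),
        a i * kantorovich (mU j) (MU j) (i : ℝ) * (pU.eval x) ^ i)
    (BU BL : K →L[ℂ] K)
    (hBU : BU = ∑ j, w j • ((adjoint V) ∘L (cfc (qU j) (A j)) ∘L V))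
    (hBL : BL = ∑ j, w j • ((adjoint V) ∘L (cfc (qL j) (A j)) ∘L V))
    (SU SL : Set ℝ)
    (hSU : SU = closure (convexHull ℝ (⋃ j, qU j '' Set.Icc (m j) (M j))))
    (hSL : SL = closure (convexHull ℝ (⋃ j, qL j '' Set.Icc (m j) (M j))))
    (hSUpos : SU ⊆ Set.Ioi (0 : ℝ)) (hSLpos : SL ⊆ Set.Ioi (0 : ℝ))
    (q α : ℝ) :
    ((∑ j, w j • ((adjoint V) ∘L (∑ i ∈ Finset.range (I + 1), a i • (cfc f (A j)) ^ i) ∘L V)) ≤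
      α • cfc (fun x : ℝ => x ^ q) BU + (sSup ((fun x => x - α * x ^ q) '' SU)) • (1 : K →L[ℂ] K)) ∧
    α • cfc (fun x : ℝ => x ^ q) BL + (sInf ((fun x => x - α * x ^ q) '' SL)) • (1 : K →L[ℂ] K) ≤
      (∑ j, w j • ((adjoint V) ∘L (∑ i ∈ Finset.range (I + 1), a i • (cfc f (A j)) ^ i) ∘L V)) := by
  have hU0 : ∀ j, 0 < mU j := fun j => hmU j ▸
    Polynomial.sInf_image_eval_Icc_pos (hmM j).le fun x hx => by
      obtain ⟨h1, h2, h3⟩ := hp x (Set.mem_iUnion_of_mem j hx)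
      linarith
  have hL0 : ∀ j, 0 < mL j := fun j => hmL j ▸
    Polynomial.sInf_image_eval_Icc_pos (hmM j).le fun x hx =>
      (hp x (Set.mem_iUnion_of_mem j hx)).1
  have hκ : ∀ j (i : ℕ), 1 ≤ kantorovich (mU j) (MU j) (i : ℝ) := fun j i =>
    one_le_kantorovich_natCast (hU0 j) (hUlt j) i
  have hμ : ∀ j (i : ℕ), 1 ≤ kantorovich (mL j) (ML j) (i : ℝ) := fun j i =>
    one_le_kantorovich_natCast (hL0 j) (hLlt j) i
  have hqUc : ∀ j, Continuous (qU j) := fun j => by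
    rw [funext (hqU j)]
    fun_prop
  have hqLc : ∀ j, Continuous (qL j) := fun j => by
    rw [funext (hqL j)]
    fun_prop
  have hfj : ∀ j, ContinuousOn f (spectrum ℝ (A j)) := fun j =>
    hf.mono ((hspec j).trans (Set.subset_iUnion (fun j => Set.Icc (m j) (M j)) j))
  have hfc : ∀ j, ContinuousOn (fun x => ∑ i ∈ Finset.range (I + 1), a i * f x ^ i)
      (spectrum ℝ (A j)) := fun j =>
    continuousOn_finsetSum _ fun i _ => continuousOn_const.mul ((hfj j).pow i)
  have hmem : ∀ (g : Fin k → ℝ → ℝ), ∀ j, ∀ x ∈ Set.Icc (m j) (M j),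
      g j x ∈ closure (convexHull ℝ (⋃ j, g j '' Set.Icc (m j) (M j))) := fun g j x hx =>
    subset_closure (subset_convexHull ℝ _ (Set.mem_iUnion_of_mem j (Set.mem_image_of_mem _ hx)))
  have hspecS : ∀ (g : Fin k → ℝ → ℝ), (∀ j, Continuous (g j)) →
      spectrum ℝ (∑ j, w j • ((adjoint V) ∘L (cfc (g j) (A j)) ∘L V)) ⊆
        closure (convexHull ℝ (⋃ j, g j '' Set.Icc (m j) (M j))) := fun g hg =>
    spectrum_sum_smul_adjoint_conj_cfc_subset hV hw hw1 hA hg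
      (isCompact_closure_convexHull_iUnion_image_Icc hg)
      ⟨_, hmem g ⟨0, hk⟩ (m ⟨0, hk⟩) (Set.left_mem_Icc.2 (hmM _).le)⟩
      (convex_convexHull ℝ _).closure.ordConnected
      fun j x hx => hmem g j x (hspec j hx)
  have hsa : ∀ g : Fin k → ℝ → ℝ,
      IsSelfAdjoint (∑ j, w j • ((adjoint V) ∘L (cfc (g j) (A j)) ∘L V)) := fun g =>
    isSelfAdjoint_sum_smul_adjoint_conj fun j => cfc_predicate _ _
  simp only [fun j => sum_smul_pow_cfc (hA j) (hfj j) a (Finset.range (I + 1))]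
  subst hBU hBL hSU hSL
  constructor
  · refine le_trans (sum_smul_adjoint_conj_mono hw fun j => ?_)
      (le_smul_cfc_rpow_add_sSup (hsa qU) (isCompact_closure_convexHull_iUnion_image_Icc hqUc)
        (hspecS qU hqUc) hSUpos q α)
    refine cfc_mono (fun x hx => ?_) (hfc j) (hqUc j).continuousOn
    obtain ⟨h1, h2, h3⟩ := hp x (Set.mem_iUnion_of_mem j (hspec j hx))
    rw [hqU]
    exact sum_mul_pow_le_of_bounds h1 h2 h3 (hκ j) (hμ j) _
  · refine le_trans
      (smul_cfc_rpow_add_sInf_le (hsa qL) (isCompact_closure_convexHull_iUnion_image_Icc hqLc)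
        (hspecS qL hqLc) hSLpos q α) (sum_smul_adjoint_conj_mono hw fun j => ?_)
    refine cfc_mono (fun x hx => ?_) (hqLc j).continuousOn (hfc j)
    obtain ⟨h1, h2, h3⟩ := hp x (Set.mem_iUnion_of_mem j (hspec j hx))
    rw [hqL]
    exact le_sum_mul_pow_of_bounds h1 h2 h3 (hκ j) (hμ j) _
end

section
/- Assume S_U ⊆ (0, ∞) and S_L ⊆ (0, ∞), and let q ∈ ℝ. Then Σ_{j=1}^k w_j Φ(f(A_j)) ≤ ( max_{x ∈ S_U} x^{1−q} )·B_U^q, and Σ_{j=1}^k w_j Φ(f(A_j)) ≥ ( min_{x ∈ S_L} x^{1−q} )·B_L^q, in the Loewner order, where the operator powers are defined by continuous functional calculus. -/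
open ContinuousLinearMap Polynomial

theorem one_le_kantorovich {m M : ℝ} (hm : 0 < m) (hM : m < M) (n : ℕ) :
    1 ≤ kantorovich m M (n : ℝ) := by
  unfold kantorovich
  split_ifs with h
  · exact le_rfl
  push Not at h
  obtain ⟨h0, h1⟩ := h
  have h0' : n ≠ 0 := by exact_mod_cast h0
  have h1' : n ≠ 1 := by exact_mod_cast h1
  have hn : 2 ≤ n := by omega
  have hnR : (2 : ℝ) ≤ n := by exact_mod_cast hn
  simp only [Real.rpow_natCast]
  have hM0 : 0 < M := hm.trans hM
  have hpow : m ^ n < M ^ n := pow_lt_pow_left₀ hM hm.le h0'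
  obtain ⟨l, rfl⟩ : ∃ l, n = l + 1 := ⟨n - 1, by omega⟩
  have hl : m ^ l < M ^ l := pow_lt_pow_left₀ hM hm.le (by omega)
  have hQ : 0 < m * M ^ (l + 1) - M * m ^ (l + 1) := by
    have : m * M ^ (l + 1) - M * m ^ (l + 1) = m * M * (M ^ l - m ^ l) := by ring
    rw [this]
    exact mul_pos (mul_pos hm hM0) (sub_pos.2 hl)
  have hQP : m * (M ^ (l + 1) - m ^ (l + 1)) - (m * M ^ (l + 1) - M * m ^ (l + 1))
      = (M - m) * m ^ (l + 1) := by ring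
  generalize l + 1 = n at *
  set Q := m * M ^ n - M * m ^ n
  set P := M ^ n - m ^ n
  have hP : 0 < P := sub_pos.2 hpow
  have hd : 0 < M - m := sub_pos.2 hM
  have hn1 : (0 : ℝ) < n - 1 := by linarith
  have hn0 : (0 : ℝ) < n := by linarith
  set s := ((n : ℝ) - 1) * P / (n * Q) with hs
  have hspos : 0 < s := by positivity
  have hB := one_add_mul_le_pow (a := s * m - 1) (by nlinarith [mul_pos hspos hm]) n
  rw [add_sub_cancel, mul_pow] at hB
  have key : Q / ((n - 1) * (M - m)) * (1 + n * (s * m - 1)) = m ^ n := by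
    have : Q * (1 + n * (s * m - 1)) = (n - 1) * (m * P - Q) := by
      rw [hs]; field_simp; ring
    rw [div_mul_eq_mul_div, this, hQP]
    field_simp
  have hmn : 0 < m ^ n := pow_pos hm n
  have hc : 0 ≤ Q / ((n - 1) * (M - m)) := by positivity
  have := mul_le_mul_of_nonneg_left hB hc
  rw [key, ← mul_assoc] at this
  exact (le_mul_iff_one_le_left hmn).1 this

theorem conj_mono {H K : Type*} [NormedAddCommGroup H] [InnerProductSpace ℂ H] [CompleteSpace H]
    [NormedAddCommGroup K] [InnerProductSpace ℂ K] [CompleteSpace K]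
    (V : K →L[ℂ] H) {X Y : H →L[ℂ] H} (h : X ≤ Y) :
    (adjoint V) ∘L X ∘L V ≤ (adjoint V) ∘L Y ∘L V := by
  rw [ContinuousLinearMap.le_def] at h ⊢
  have := h.adjoint_conj V
  simpa only [ContinuousLinearMap.sub_comp, ContinuousLinearMap.comp_sub] using this

theorem sum_conj_mono {H K : Type*} [NormedAddCommGroup H] [InnerProductSpace ℂ H]
    [CompleteSpace H] [NormedAddCommGroup K] [InnerProductSpace ℂ K] [CompleteSpace K]
    (V : K →L[ℂ] H) {ι : Type*} [Fintype ι] {w : ι → ℝ} (hw : ∀ j, 0 ≤ w j)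
    {X Y : ι → H →L[ℂ] H} (h : ∀ j, X j ≤ Y j) :
    ∑ j, w j • ((adjoint V) ∘L X j ∘L V) ≤ ∑ j, w j • ((adjoint V) ∘L Y j ∘L V) :=
  Finset.sum_le_sum fun j _ => smul_le_smul_of_nonneg_left (conj_mono V (h j)) (hw j)

theorem sum_conj_algebraMap {H K : Type*} [NormedAddCommGroup H] [InnerProductSpace ℂ H]
    [CompleteSpace H] [NormedAddCommGroup K] [InnerProductSpace ℂ K] [CompleteSpace K]
    {V : K →L[ℂ] H} (hV : (adjoint V) ∘L V = 1) {ι : Type*} [Fintype ι] {w : ι → ℝ}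
    (hw1 : ∑ j, w j = 1) (c : ℝ) :
    ∑ j, w j • ((adjoint V) ∘L (algebraMap ℝ (H →L[ℂ] H) c) ∘L V)
      = algebraMap ℝ (K →L[ℂ] K) c := by
  have h : (adjoint V) ∘L (algebraMap ℝ (H →L[ℂ] H) c) ∘L V = algebraMap ℝ (K →L[ℂ] K) c := by
    rw [Algebra.algebraMap_eq_smul_one, Algebra.algebraMap_eq_smul_one, ← hV]
    ext x
    simp
  simp_rw [h]
  rw [← Finset.sum_smul, hw1, one_smul]

theorem spectrum_sum_conj_cfc_subset {H K : Type*} [NormedAddCommGroup H] [InnerProductSpace ℂ H]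
    [CompleteSpace H] [NormedAddCommGroup K] [InnerProductSpace ℂ K] [CompleteSpace K]
    {V : K →L[ℂ] H} (hV : (adjoint V) ∘L V = 1) {ι : Type*} [Fintype ι] {w : ι → ℝ}
    (hw : ∀ j, 0 ≤ w j) (hw1 : ∑ j, w j = 1) {A : ι → H →L[ℂ] H}
    (hA : ∀ j, IsSelfAdjoint (A j)) {g : ι → ℝ → ℝ} (hg : ∀ j, Continuous (g j))
    {S : Set ℝ} (hS : IsCompact S) (hSc : Convex ℝ S) (hSne : S.Nonempty)
    (hgS : ∀ j, ∀ x ∈ spectrum ℝ (A j), g j x ∈ S) :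
    IsSelfAdjoint (∑ j, w j • ((adjoint V) ∘L (cfc (g j) (A j)) ∘L V)) ∧
    spectrum ℝ (∑ j, w j • ((adjoint V) ∘L (cfc (g j) (A j)) ∘L V)) ⊆ S := by
  have hsa : IsSelfAdjoint (∑ j, w j • ((adjoint V) ∘L (cfc (g j) (A j)) ∘L V)) := by
    refine isSelfAdjoint_sum _ fun j _ => IsSelfAdjoint.smul (IsSelfAdjoint.all _) ?_
    exact (cfc_predicate (g j) (A j) : IsSelfAdjoint _).adjoint_conj V
  refine ⟨hsa, fun x hx => ?_⟩
  obtain ⟨c, hc, hcle⟩ := hS.exists_isLeast hSne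
  obtain ⟨d, hd, hdle⟩ := hS.exists_isGreatest hSne
  have h1 : algebraMap ℝ (K →L[ℂ] K) c ≤
      ∑ j, w j • ((adjoint V) ∘L (cfc (g j) (A j)) ∘L V) := by
    rw [← sum_conj_algebraMap hV hw1]
    refine sum_conj_mono V hw fun j => ?_
    exact algebraMap_le_cfc (g j) c (A j) (fun x hx => hcle (hgS j x hx))
      (hg j).continuousOn (hA j)
  have h2 : ∑ j, w j • ((adjoint V) ∘L (cfc (g j) (A j)) ∘L V) ≤
      algebraMap ℝ (K →L[ℂ] K) d := by
    rw [← sum_conj_algebraMap hV hw1]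
    refine sum_conj_mono V hw fun j => ?_
    exact cfc_le_algebraMap (g j) d (A j) (fun x hx => hdle (hgS j x hx))
      (hg j).continuousOn (hA j)
  rw [algebraMap_le_iff_le_spectrum hsa] at h1
  rw [le_algebraMap_iff_spectrum_le hsa] at h2
  exact hSc.ordConnected.out hc hd ⟨h1 x hx, h2 x hx⟩

theorem le_sSup_rpow_smul_cfc {K : Type*} [NormedAddCommGroup K] [InnerProductSpace ℂ K]
    [CompleteSpace K] {B : K →L[ℂ] K} (hB : IsSelfAdjoint B) {S : Set ℝ} (hS : IsCompact S)
    (hSpos : S ⊆ Set.Ioi 0) (hBS : spectrum ℝ B ⊆ S) (q : ℝ) :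
    B ≤ (sSup ((fun x : ℝ => x ^ (1 - q)) '' S)) • cfc (fun x : ℝ => x ^ q) B := by
  have hcont : ∀ r : ℝ, ContinuousOn (fun x : ℝ => x ^ r) S := fun r x hx =>
    (Real.continuousAt_rpow_const x r (Or.inl (ne_of_gt (hSpos hx)))).continuousWithinAt
  rw [← cfc_const_mul _ _ B ((hcont q).mono hBS)]
  nth_rewrite 1 [← cfc_id' ℝ B]
  refine cfc_mono (fun x hx => ?_) continuousOn_id
    (continuousOn_const.mul ((hcont q).mono hBS))
  have hx0 : 0 < x := hSpos (hBS hx)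
  calc x = x ^ (1 - q) * x ^ q := by rw [← Real.rpow_add hx0]; simp
    _ ≤ _ := mul_le_mul_of_nonneg_right
      (le_csSup (hS.image_of_continuousOn (hcont _)).bddAbove ⟨x, hBS hx, rfl⟩)
      (Real.rpow_nonneg hx0.le q)

theorem sInf_rpow_smul_cfc_le {K : Type*} [NormedAddCommGroup K] [InnerProductSpace ℂ K]
    [CompleteSpace K] {B : K →L[ℂ] K} (hB : IsSelfAdjoint B) {S : Set ℝ} (hS : IsCompact S)
    (hSpos : S ⊆ Set.Ioi 0) (hBS : spectrum ℝ B ⊆ S) (q : ℝ) :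
    (sInf ((fun x : ℝ => x ^ (1 - q)) '' S)) • cfc (fun x : ℝ => x ^ q) B ≤ B := by
  have hcont : ∀ r : ℝ, ContinuousOn (fun x : ℝ => x ^ r) S := fun r x hx =>
    (Real.continuousAt_rpow_const x r (Or.inl (ne_of_gt (hSpos hx)))).continuousWithinAt
  rw [← cfc_const_mul _ _ B ((hcont q).mono hBS)]
  nth_rewrite 2 [← cfc_id' ℝ B]
  refine cfc_mono (fun x hx => ?_) (continuousOn_const.mul ((hcont q).mono hBS)) continuousOn_id
  have hx0 : 0 < x := hSpos (hBS hx)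
  calc _ ≤ x ^ (1 - q) * x ^ q := mul_le_mul_of_nonneg_right
        (csInf_le (hS.image_of_continuousOn (hcont _)).bddBelow ⟨x, hBS hx, rfl⟩)
        (Real.rpow_nonneg hx0.le q)
    _ = x := by rw [← Real.rpow_add hx0]; simp

theorem sum_smul_cfc_pow {H : Type*} [NormedAddCommGroup H] [InnerProductSpace ℂ H]
    [CompleteSpace H] {A : H →L[ℂ] H} (hA : IsSelfAdjoint A) {f : ℝ → ℝ}
    (hf : ContinuousOn f (spectrum ℝ A)) (s : Finset ℕ) (a : ℕ → ℝ) :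
    ∑ i ∈ s, a i • (cfc f A) ^ i = cfc (fun x => ∑ i ∈ s, a i * f x ^ i) A := by
  have h : (fun x => ∑ i ∈ s, a i * f x ^ i) = ∑ i ∈ s, fun x => a i * f x ^ i := by
    ext x; simp
  rw [h, cfc_sum (fun i x => a i * f x ^ i) A s fun i _ => continuousOn_const.mul (hf.pow i)]
  refine Finset.sum_congr rfl fun i _ => ?_
  rw [cfc_const_mul (a i) (fun x => f x ^ i) A (hf.pow i), cfc_pow f i A hf]

theorem isCompact_closure_convexHull_iUnion_image {ι : Type*} [Finite ι] {g : ι → ℝ → ℝ}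
    (hg : ∀ j, Continuous (g j)) (m M : ι → ℝ) :
    IsCompact (closure (convexHull ℝ (⋃ j, g j '' Set.Icc (m j) (M j)))) := by
  have h : IsCompact (⋃ j, g j '' Set.Icc (m j) (M j)) :=
    isCompact_iUnion fun j => isCompact_Icc.image (hg j)
  exact (isBounded_convexHull.2 h.isBounded).isCompact_closure

theorem sInf_image_Icc_pos {g : ℝ → ℝ} (hg : Continuous g) {m M : ℝ} (hmM : m ≤ M)
    (h : ∀ x ∈ Set.Icc m M, 0 < g x) : 0 < sInf (g '' Set.Icc m M) := by
  obtain ⟨x, hx, hxe⟩ := (isCompact_Icc.image hg).sInf_mem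
    ((Set.nonempty_Icc.2 hmM).image g)
  exact hxe ▸ h x hx

/-- Positive coefficients are paired with an upper bound of `y ^ i`, negative ones with a lower
bound. -/
theorem sum_mul_pow_le_sum_filter {n : ℕ} {a c d : ℕ → ℝ} {y l u : ℝ}
    (hc : ∀ i, 1 ≤ c i) (hd : ∀ i, 1 ≤ d i) (hl : 0 < l) (hly : l ≤ y) (hyu : y ≤ u) :
    ∑ i ∈ Finset.range n, a i * y ^ i ≤
      (∑ i ∈ (Finset.range n).filter (fun i => 0 ≤ a i), a i * c i * u ^ i) +
        ∑ i ∈ (Finset.range n).filter (fun i => a i < 0), a i * (d i)⁻¹ * l ^ i := by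
  rw [← Finset.sum_filter_add_sum_filter_not _ (fun i => 0 ≤ a i)]
  simp only [not_le]
  refine add_le_add (Finset.sum_le_sum fun i hi => ?_) (Finset.sum_le_sum fun i hi => ?_)
  · have ha := (Finset.mem_filter.1 hi).2
    have hy : 0 ≤ y := hl.le.trans hly
    rw [mul_assoc]
    refine mul_le_mul_of_nonneg_left ?_ ha
    exact (pow_le_pow_left₀ hy hyu i).trans
      (le_mul_of_one_le_left (pow_nonneg (hy.trans hyu) i) (hc i))
  · have ha := (Finset.mem_filter.1 hi).2
    rw [mul_assoc]
    refine mul_le_mul_of_nonpos_left ?_ ha.le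
    exact (mul_le_of_le_one_left (pow_nonneg hl.le i) (inv_le_one_of_one_le₀ (hd i))).trans
      (pow_le_pow_left₀ hl.le hly i)

theorem sum_filter_le_sum_mul_pow {n : ℕ} {a c d : ℕ → ℝ} {y l u : ℝ}
    (hc : ∀ i, 1 ≤ c i) (hd : ∀ i, 1 ≤ d i) (hl : 0 < l) (hly : l ≤ y) (hyu : y ≤ u) :
    (∑ i ∈ (Finset.range n).filter (fun i => 0 ≤ a i), a i * (d i)⁻¹ * l ^ i) +
        ∑ i ∈ (Finset.range n).filter (fun i => a i < 0), a i * c i * u ^ i ≤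
      ∑ i ∈ Finset.range n, a i * y ^ i := by
  rw [← Finset.sum_filter_add_sum_filter_not (Finset.range n) (fun i => 0 ≤ a i)]
  simp only [not_le]
  refine add_le_add (Finset.sum_le_sum fun i hi => ?_) (Finset.sum_le_sum fun i hi => ?_)
  · have ha := (Finset.mem_filter.1 hi).2
    rw [mul_assoc]
    refine mul_le_mul_of_nonneg_left ?_ ha
    exact (mul_le_of_le_one_left (pow_nonneg hl.le i) (inv_le_one_of_one_le₀ (hd i))).trans
      (pow_le_pow_left₀ hl.le hly i)
  · have ha := (Finset.mem_filter.1 hi).2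
    have hy : 0 ≤ y := hl.le.trans hly
    rw [mul_assoc]
    refine mul_le_mul_of_nonpos_left ?_ ha.le
    exact (pow_le_pow_left₀ hy hyu i).trans
      (le_mul_of_one_le_left (pow_nonneg (hy.trans hyu) i) (hc i))

theorem stmt10
    {H K : Type*} [NormedAddCommGroup H] [InnerProductSpace ℂ H] [CompleteSpace H]
    [NormedAddCommGroup K] [InnerProductSpace ℂ K] [CompleteSpace K]
    (V : K →L[ℂ] H) (hV : (adjoint V) ∘L V = 1)
    (I : ℕ) (a : ℕ → ℝ)
    (k : ℕ) (hk : 1 ≤ k)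
    (w : Fin k → ℝ) (hw : ∀ j, 0 ≤ w j) (hw1 : ∑ j, w j = 1)
    (m M : Fin k → ℝ) (hmM : ∀ j, m j < M j)
    (A : Fin k → H →L[ℂ] H) (hA : ∀ j, IsSelfAdjoint (A j))
    (hspec : ∀ j, spectrum ℝ (A j) ⊆ Set.Icc (m j) (M j))
    (f : ℝ → ℝ) (hf : ContinuousOn f (⋃ j, Set.Icc (m j) (M j)))
    (pL pU : Polynomial ℝ)
    (hp : ∀ x ∈ ⋃ j, Set.Icc (m j) (M j),
      0 < pL.eval x ∧ pL.eval x ≤ f x ∧ f x ≤ pU.eval x)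
    (mU MU mL ML : Fin k → ℝ)
    (hmU : ∀ j, mU j = sInf ((fun x => pU.eval x) '' Set.Icc (m j) (M j)))
    (hMU : ∀ j, MU j = sSup ((fun x => pU.eval x) '' Set.Icc (m j) (M j)))
    (hmL : ∀ j, mL j = sInf ((fun x => pL.eval x) '' Set.Icc (m j) (M j)))
    (hML : ∀ j, ML j = sSup ((fun x => pL.eval x) '' Set.Icc (m j) (M j)))
    (hUlt : ∀ j, mU j < MU j) (hLlt : ∀ j, mL j < ML j)
    (qU qL : Fin k → ℝ → ℝ)
    (hqU : ∀ j x, qU j x =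
      (∑ i ∈ (Finset.range (I + 1)).filter (fun i => 0 ≤ a i),
        a i * kantorovich (mU j) (MU j) (i : ℝ) * (pU.eval x) ^ i) +
      ∑ i ∈ (Finset.range (I + 1)).filter (fun i => a i < 0),
        a i * (kantorovich (mL j) (ML j) (i : ℝ))⁻¹ * (pL.eval x) ^ i)
    (hqL : ∀ j x, qL j x =
      (∑ i ∈ (Finset.range (I + 1)).filter (fun i => 0 ≤ a i),
        a i * (kantorovich (mL j) (ML j) (i : ℝ))⁻¹ * (pL.eval x) ^ i) +
      ∑ i ∈ (Finset.range (I + 1)).filter (fun i => a i < 0),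
        a i * kantorovich (mU j) (MU j) (i : ℝ) * (pU.eval x) ^ i)
    (BU BL : K →L[ℂ] K)
    (hBU : BU = ∑ j, w j • ((adjoint V) ∘L (cfc (qU j) (A j)) ∘L V))
    (hBL : BL = ∑ j, w j • ((adjoint V) ∘L (cfc (qL j) (A j)) ∘L V))
    (SU SL : Set ℝ)
    (hSU : SU = closure (convexHull ℝ (⋃ j, qU j '' Set.Icc (m j) (M j))))
    (hSL : SL = closure (convexHull ℝ (⋃ j, qL j '' Set.Icc (m j) (M j))))
    (hSUpos : SU ⊆ Set.Ioi (0 : ℝ)) (hSLpos : SL ⊆ Set.Ioi (0 : ℝ))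
    (q : ℝ) :
    ((∑ j, w j • ((adjoint V) ∘L (∑ i ∈ Finset.range (I + 1), a i • (cfc f (A j)) ^ i) ∘L V)) ≤
      (sSup ((fun x : ℝ => x ^ (1 - q)) '' SU)) • cfc (fun x : ℝ => x ^ q) BU) ∧
    (sInf ((fun x : ℝ => x ^ (1 - q)) '' SL)) • cfc (fun x : ℝ => x ^ q) BL ≤
      (∑ j, w j • ((adjoint V) ∘L (∑ i ∈ Finset.range (I + 1), a i • (cfc f (A j)) ^ i) ∘L V)) := by
  have hmem : ∀ j, ∀ x ∈ Set.Icc (m j) (M j), x ∈ ⋃ j, Set.Icc (m j) (M j) :=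
    fun j x hx => Set.mem_iUnion.2 ⟨j, hx⟩
  have hmUpos : ∀ j, 0 < mU j := fun j => by
    rw [hmU]
    refine sInf_image_Icc_pos pU.continuous (hmM j).le fun x hx => ?_
    obtain ⟨h0, h1, h2⟩ := hp x (hmem j x hx)
    linarith
  have hmLpos : ∀ j, 0 < mL j := fun j => by
    rw [hmL]
    exact sInf_image_Icc_pos pL.continuous (hmM j).le fun x hx => (hp x (hmem j x hx)).1
  have hKU : ∀ j (i : ℕ), 1 ≤ kantorovich (mU j) (MU j) (i : ℝ) :=
    fun j => one_le_kantorovich (hmUpos j) (hUlt j)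
  have hKL : ∀ j (i : ℕ), 1 ≤ kantorovich (mL j) (ML j) (i : ℝ) :=
    fun j => one_le_kantorovich (hmLpos j) (hLlt j)
  have hqUc : ∀ j, Continuous (qU j) := fun j => by
    rw [funext (hqU j)]; fun_prop
  have hqLc : ∀ j, Continuous (qL j) := fun j => by
    rw [funext (hqL j)]; fun_prop
  have hfc : ∀ j, ContinuousOn f (spectrum ℝ (A j)) := fun j =>
    hf.mono fun x hx => hmem j x (hspec j hx)
  have hsumc : ∀ j, ContinuousOn (fun x => ∑ i ∈ Finset.range (I + 1), a i * f x ^ i)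
      (spectrum ℝ (A j)) := fun j =>
    continuousOn_finsetSum _ fun i _ => ((hfc j).pow i).const_smul (a i)
  have hmemS : ∀ (g : Fin k → ℝ → ℝ) j, ∀ x ∈ Set.Icc (m j) (M j),
      g j x ∈ closure (convexHull ℝ (⋃ j, g j '' Set.Icc (m j) (M j))) := fun g j x hx =>
    subset_closure (subset_convexHull ℝ _ (Set.mem_iUnion.2 ⟨j, x, hx, rfl⟩))
  have hne : ∀ g : Fin k → ℝ → ℝ,
      (closure (convexHull ℝ (⋃ j, g j '' Set.Icc (m j) (M j)))).Nonempty := fun g =>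
    ⟨_, hmemS g ⟨0, hk⟩ _ (Set.left_mem_Icc.2 (hmM _).le)⟩
  have hspecB := fun (g : Fin k → ℝ → ℝ) (hg : ∀ j, Continuous (g j)) =>
    spectrum_sum_conj_cfc_subset hV hw hw1 hA hg
      (isCompact_closure_convexHull_iUnion_image hg m M) (convex_convexHull ℝ _).closure (hne g)
      fun j x hx => hmemS g j x (hspec j hx)
  simp_rw [fun j => sum_smul_cfc_pow (hA j) (hfc j) (Finset.range (I + 1)) a]
  subst hSU hSL hBU hBL
  constructor
  · refine le_trans (sum_conj_mono V hw fun j => cfc_mono (fun x hx => ?_) (hsumc j)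
      (hqUc j).continuousOn) (le_sSup_rpow_smul_cfc (hspecB qU hqUc).1
        (isCompact_closure_convexHull_iUnion_image hqUc m M) hSUpos (hspecB qU hqUc).2 q)
    obtain ⟨h0, h1, h2⟩ := hp x (hmem j x (hspec j hx))
    rw [hqU]
    exact sum_mul_pow_le_sum_filter (hKU j) (hKL j) h0 h1 h2
  · refine le_trans (sInf_rpow_smul_cfc_le (hspecB qL hqLc).1
        (isCompact_closure_convexHull_iUnion_image hqLc m M) hSLpos (hspecB qL hqLc).2 q)
      (sum_conj_mono V hw fun j => cfc_mono (fun x hx => ?_) (hqLc j).continuousOn (hsumc j))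
    obtain ⟨h0, h1, h2⟩ := hp x (hmem j x (hspec j hx))
    rw [hqL]
    exact sum_filter_le_sum_mul_pow (hKU j) (hKL j) h0 h1 h2
end
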